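/- Let α ∈ (0,1), K > 0, t ∈ (0, 1/2], and let f, g : ℝ → ℝ be 2π-periodic functions, each α-Hölder with constant K, such that sup_{ξ ∈ ℝ} |f(ξ) − g(ξ)| ≤ K·t^α. Then the Hilbert transforms Hf and Hg are defined pointwise, and there exists a constant C depending only on α such that for every ξ ∈ ℝ, |Hf(ξ) − Hg(ξ)| ≤ C·K·t^α·(1 + log(1/t)). -/

import Mathlib

open MeasureTheory

/-- `IsHilbertTransformAt f ξ L` says that the principal value
`(1/π) · lim_{ε→0⁺} ∫_{ε ≤ |θ| ≤ π} cot(θ/2)·f(ξ - θ) dθ` exists and equals `L`;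
i.e. `L` is the value of the (circle) Hilbert transform of `f` at `ξ`. -/
def IsHilbertTransformAt (f : ℝ → ℝ) (ξ L : ℝ) : Prop :=
  Filter.Tendsto
    (fun ε : ℝ => (1 / Real.pi) *
      ∫ θ in {θ : ℝ | ε ≤ |θ| ∧ |θ| ≤ Real.pi}, Real.cot (θ/2) * f (ξ - θ))
    (nhdsWithin 0 (Set.Ioi 0)) (nhds L)

lemma Real.cot_nonneg_of_mem_Ioc {x : ℝ} (hx : 0 < x) (hx' : x ≤ Real.pi / 2) :
    0 ≤ Real.cot x := by
  rw [Real.cot_eq_cos_div_sin]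
  exact div_nonneg (Real.cos_nonneg_of_mem_Icc ⟨by linarith, hx'⟩)
    (Real.sin_nonneg_of_nonneg_of_le_pi hx.le (by linarith [Real.pi_pos]))

lemma Real.cot_le_inv {x : ℝ} (hx : 0 < x) (hx' : x ≤ Real.pi / 2) : Real.cot x ≤ x⁻¹ := by
  rcases hx'.eq_or_lt with rfl | h
  · rw [Real.cot_eq_cos_div_sin, Real.cos_pi_div_two, zero_div]
    positivity
  · have h1 : x ≤ Real.tan x := (Real.lt_tan hx h).le
    have h2 := inv_anti₀ hx h1
    rwa [Real.tan_inv_eq_cot] at h2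

lemma abs_cot_half_le {θ : ℝ} (h0 : 0 < θ) (h1 : θ ≤ Real.pi) :
    |Real.cot (θ / 2)| ≤ 2 * θ⁻¹ := by
  rw [abs_of_nonneg (Real.cot_nonneg_of_mem_Ioc (by linarith) (by linarith))]
  refine (Real.cot_le_inv (by linarith) (by linarith)).trans_eq ?_
  rw [inv_div, div_eq_mul_inv]

lemma continuousOn_cot_half {s : Set ℝ} (hs : ∀ θ ∈ s, θ ≠ 0 ∧ |θ| ≤ Real.pi) :
    ContinuousOn (fun θ : ℝ => Real.cot (θ / 2)) s := by
  simp only [Real.cot_eq_cos_div_sin]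
  refine ContinuousOn.div (by fun_prop) (by fun_prop) fun θ hθ => ?_
  obtain ⟨h0, h1⟩ := hs θ hθ
  rw [abs_le] at h1
  have := Real.pi_pos
  rw [Ne, Real.sin_eq_zero_iff_of_lt_of_lt (by linarith) (by linarith)]
  intro h
  exact h0 (by linarith)

lemma continuous_of_abs_sub_le_rpow {f : ℝ → ℝ} {K α : ℝ} (hα : 0 < α)
    (hf : ∀ s u : ℝ, |f s - f u| ≤ K * |s - u| ^ α) : Continuous f := by
  rw [continuous_iff_continuousAt]
  intro u
  rw [ContinuousAt, tendsto_iff_dist_tendsto_zero]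
  refine squeeze_zero (fun _ => dist_nonneg) (fun s => hf s u) ?_
  have : Continuous fun s : ℝ => K * |s - u| ^ α :=
    continuous_const.mul ((by fun_prop : Continuous fun s : ℝ => |s - u|).rpow_const
      fun _ => Or.inr hα.le)
  simpa [Real.zero_rpow hα.ne'] using this.tendsto u

/-- The integrand of the Hilbert transform at `ξ` after folding `[-π, π]` onto `[0, π]`. -/
noncomputable def foldedHilbertIntegrand (f : ℝ → ℝ) (ξ θ : ℝ) : ℝ :=
  Real.cot (θ / 2) * (f (ξ - θ) - f (ξ + θ))

lemma continuousOn_foldedHilbertIntegrand {f : ℝ → ℝ} (hf : Continuous f) (ξ : ℝ) :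
    ContinuousOn (foldedHilbertIntegrand f ξ) (Set.Ioc 0 Real.pi) := by
  refine ContinuousOn.mul (continuousOn_cot_half fun θ hθ => ⟨hθ.1.ne', ?_⟩) (by fun_prop)
  rw [abs_of_pos hθ.1]
  exact hθ.2

lemma setIntegral_cot_mul_eq {f : ℝ → ℝ} (hf : Continuous f) (ξ : ℝ) {ε : ℝ} (hε : 0 < ε)
    (hεπ : ε ≤ Real.pi) :
    ∫ θ in {θ : ℝ | ε ≤ |θ| ∧ |θ| ≤ Real.pi}, Real.cot (θ / 2) * f (ξ - θ) =
      ∫ θ in ε..Real.pi, foldedHilbertIntegrand f ξ θ := by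
  have hset : {θ : ℝ | ε ≤ |θ| ∧ |θ| ≤ Real.pi} =
      Set.Icc (-Real.pi) (-ε) ∪ Set.Icc ε Real.pi := by
    ext θ
    simp only [Set.mem_ofPred_eq, Set.mem_union, Set.mem_Icc]
    rcases le_total 0 θ with h | h
    · rw [abs_of_nonneg h]
      exact ⟨Or.inr, fun h' => h'.elim (fun h' => by linarith [h'.2]) id⟩
    · rw [abs_of_nonpos h]
      exact ⟨fun h' => Or.inl ⟨by linarith, by linarith⟩,
        fun h' => h'.elim (fun h' => ⟨by linarith, by linarith⟩) (fun h' => by linarith [h'.1])⟩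
  have hpos : ContinuousOn (fun θ : ℝ => Real.cot (θ / 2)) (Set.Icc ε Real.pi) :=
    continuousOn_cot_half fun θ hθ =>
      ⟨by linarith [hθ.1], abs_le.2 ⟨by linarith [hθ.1], hθ.2⟩⟩
  have hneg : ContinuousOn (fun θ : ℝ => Real.cot (θ / 2)) (Set.Icc (-Real.pi) (-ε)) :=
    continuousOn_cot_half fun θ hθ =>
      ⟨by linarith [hθ.2], abs_le.2 ⟨hθ.1, by linarith [hθ.2]⟩⟩
  have hint : ∀ {u : ℝ → ℝ}, Continuous u → IntervalIntegrable
      (fun θ => Real.cot (θ / 2) * u θ) volume ε Real.pi := fun hu =>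
    (ContinuousOn.mul hpos hu.continuousOn).intervalIntegrable_of_Icc hεπ
  have hcont : ∀ {s : Set ℝ}, ContinuousOn (fun θ : ℝ => Real.cot (θ / 2)) s →
      ContinuousOn (fun θ : ℝ => Real.cot (θ / 2) * f (ξ - θ)) s := fun hs =>
    ContinuousOn.mul hs (by fun_prop)
  have hdisj : Disjoint (Set.Icc (-Real.pi) (-ε)) (Set.Icc ε Real.pi) :=
    Set.disjoint_left.2 fun θ h h' => by linarith [h.2, h'.1]
  have hfold : ∫ θ in -Real.pi..-ε, Real.cot (θ / 2) * f (ξ - θ) =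
      -∫ θ in ε..Real.pi, Real.cot (θ / 2) * f (ξ + θ) := by
    rw [← intervalIntegral.integral_comp_neg, ← intervalIntegral.integral_neg]
    refine intervalIntegral.integral_congr fun θ _ => ?_
    simp [Real.cot_eq_cos_div_sin, neg_div, div_neg]
  rw [hset, setIntegral_union hdisj measurableSet_Icc
      (hcont hneg).integrableOn_Icc (hcont hpos).integrableOn_Icc,
    integral_Icc_eq_integral_Ioc, integral_Icc_eq_integral_Ioc,
    ← intervalIntegral.integral_of_le (by linarith), ← intervalIntegral.integral_of_le hεπ, hfold,
    neg_add_eq_sub, ← intervalIntegral.integral_sub (hint (by fun_prop)) (hint (by fun_prop))]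
  simp only [foldedHilbertIntegrand, mul_sub]

lemma abs_foldedHilbertIntegrand_le {f : ℝ → ℝ} {K α : ℝ} (hα : α ≤ 1) (hK : 0 ≤ K)
    (hf : ∀ s u : ℝ, |f s - f u| ≤ K * |s - u| ^ α) (ξ : ℝ) {θ : ℝ} (h0 : 0 < θ)
    (h1 : θ ≤ Real.pi) :
    |foldedHilbertIntegrand f ξ θ| ≤ 4 * K * θ ^ (α - 1) := by
  have h2 : |f (ξ - θ) - f (ξ + θ)| ≤ 2 * K * θ ^ α := by
    refine (hf _ _).trans ?_
    rw [show ξ - θ - (ξ + θ) = -(2 * θ) by ring, abs_neg, abs_of_pos (by linarith),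
      Real.mul_rpow zero_le_two h0.le]
    have : (2 : ℝ) ^ α ≤ 2 := by
      simpa using Real.rpow_le_rpow_of_exponent_le one_le_two hα
    calc K * (2 ^ α * θ ^ α) = 2 ^ α * (K * θ ^ α) := by ring
      _ ≤ 2 * (K * θ ^ α) := by gcongr
      _ = _ := by ring
  rw [foldedHilbertIntegrand, abs_mul, Real.rpow_sub_one h0.ne']
  calc _ ≤ (2 * θ⁻¹) * (2 * K * θ ^ α) := by
        gcongr
        exact abs_cot_half_le h0 h1
    _ = _ := by ring

lemma intervalIntegrable_foldedHilbertIntegrand {f : ℝ → ℝ} {K α : ℝ}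
    (hα : α ∈ Set.Ioo (0 : ℝ) 1) (hK : 0 ≤ K)
    (hf : ∀ s u : ℝ, |f s - f u| ≤ K * |s - u| ^ α) (ξ : ℝ) :
    IntervalIntegrable (foldedHilbertIntegrand f ξ) volume 0 Real.pi := by
  have hg : IntervalIntegrable (fun θ : ℝ => 4 * K * θ ^ (α - 1)) volume 0 Real.pi :=
    (intervalIntegral.intervalIntegrable_rpow' (by linarith [hα.1])).const_mul _
  refine hg.mono_fun ?_ ?_
  · rw [Set.uIoc_of_le Real.pi_pos.le]
    exact (continuousOn_foldedHilbertIntegrand (continuous_of_abs_sub_le_rpow hα.1 hf)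
      ξ).aestronglyMeasurable measurableSet_Ioc
  · rw [Set.uIoc_of_le Real.pi_pos.le]
    filter_upwards [ae_restrict_mem measurableSet_Ioc] with θ hθ
    exact (abs_foldedHilbertIntegrand_le hα.2.le hK hf ξ hθ.1 hθ.2).trans (le_abs_self _)

lemma isHilbertTransformAt_of_holder {f : ℝ → ℝ} {K α : ℝ}
    (hα : α ∈ Set.Ioo (0 : ℝ) 1) (hK : 0 ≤ K)
    (hf : ∀ s u : ℝ, |f s - f u| ≤ K * |s - u| ^ α) (ξ : ℝ) :
    IsHilbertTransformAt f ξ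
      ((1 / Real.pi) * ∫ θ in (0 : ℝ)..Real.pi, foldedHilbertIntegrand f ξ θ) := by
  have hi := intervalIntegrable_foldedHilbertIntegrand hα hK hf ξ
  have hc : ContinuousOn (fun ε => ∫ θ in ε..Real.pi, foldedHilbertIntegrand f ξ θ)
      (Set.uIcc 0 Real.pi) :=
    intervalIntegral.continuousOn_primitive_interval_left
      (by rwa [Set.uIcc_of_le Real.pi_pos.le,
        ← intervalIntegrable_iff_integrableOn_Icc_of_le Real.pi_pos.le])
  rw [Set.uIcc_of_le Real.pi_pos.le] at hc
  have ht := (hc 0 ⟨le_rfl, Real.pi_pos.le⟩).tendsto.mono_left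
    (nhdsWithin_mono 0 (Set.Ioc_subset_Icc_self))
  rw [nhdsWithin_Ioc_eq_nhdsGT Real.pi_pos] at ht
  refine Filter.Tendsto.const_mul _ (ht.congr' ?_)
  filter_upwards [Ioc_mem_nhdsGT Real.pi_pos] with ε hε
  exact (setIntegral_cot_mul_eq (continuous_of_abs_sub_le_rpow hα.1 hf) ξ hε.1 hε.2).symm

lemma abs_integral_foldedHilbertIntegrand_sub_le {f g : ℝ → ℝ} {K α t : ℝ}
    (hα : α ∈ Set.Ioo (0 : ℝ) 1) (hK : 0 ≤ K) (ht : 0 < t) (htπ : t ≤ Real.pi)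
    (hf : ∀ s u : ℝ, |f s - f u| ≤ K * |s - u| ^ α)
    (hg : ∀ s u : ℝ, |g s - g u| ≤ K * |s - u| ^ α)
    (hfg : ∀ ξ : ℝ, |f ξ - g ξ| ≤ K * t ^ α) (ξ : ℝ) :
    |(∫ θ in (0 : ℝ)..Real.pi, foldedHilbertIntegrand f ξ θ) -
      ∫ θ in (0 : ℝ)..Real.pi, foldedHilbertIntegrand g ξ θ| ≤
      8 * K * (t ^ α / α) + 4 * K * t ^ α * Real.log (Real.pi / t) := by
  have hif := intervalIntegrable_foldedHilbertIntegrand hα hK hf ξ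
  have hig := intervalIntegrable_foldedHilbertIntegrand hα hK hg ξ
  have hi := hif.sub hig
  have hmem : t ∈ Set.uIcc 0 Real.pi := by
    rw [Set.uIcc_of_le Real.pi_pos.le]
    exact ⟨ht.le, htπ⟩
  rw [← intervalIntegral.integral_sub hif hig, ← intervalIntegral.integral_add_adjacent_intervals
    (hi.mono_set (Set.uIcc_subset_uIcc_left hmem)) (hi.mono_set (Set.uIcc_subset_uIcc_right hmem))]
  refine (abs_add_le _ _).trans (add_le_add ?_ ?_)
  · calc _ ≤ ∫ θ in (0 : ℝ)..t, 8 * K * θ ^ (α - 1) := by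
          rw [← Real.norm_eq_abs]
          refine intervalIntegral.norm_integral_le_of_norm_le ht.le
            (Filter.Eventually.of_forall fun θ hθ => ?_)
            ((intervalIntegral.intervalIntegrable_rpow' (by linarith [hα.1])).const_mul _)
          have h1 := abs_foldedHilbertIntegrand_le hα.2.le hK hf ξ hθ.1 (hθ.2.trans htπ)
          have h2 := abs_foldedHilbertIntegrand_le hα.2.le hK hg ξ hθ.1 (hθ.2.trans htπ)
          exact (abs_sub _ _).trans (by linarith)
      _ = _ := by
          rw [intervalIntegral.integral_const_mul, integral_rpow (Or.inl (by linarith [hα.1])),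
            sub_add_cancel, Real.zero_rpow hα.1.ne', sub_zero]
  · have h0 : (0 : ℝ) ∉ Set.uIcc t Real.pi := by
      rw [Set.uIcc_of_le htπ]
      exact fun h => ht.not_ge h.1
    calc _ ≤ ∫ θ in t..Real.pi, 4 * K * t ^ α * θ⁻¹ := by
          rw [← Real.norm_eq_abs]
          refine intervalIntegral.norm_integral_le_of_norm_le htπ
            (Filter.Eventually.of_forall fun θ hθ => ?_)
            ((intervalIntegral.intervalIntegrable_inv (fun x hx h => h0 (h ▸ hx))
              continuousOn_id).const_mul _)
          have h1 := abs_sub (f (ξ - θ) - g (ξ - θ)) (f (ξ + θ) - g (ξ + θ))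
          rw [Real.norm_eq_abs, foldedHilbertIntegrand, foldedHilbertIntegrand, ← mul_sub,
            abs_mul]
          calc _ ≤ (2 * θ⁻¹) * (2 * (K * t ^ α)) := by
                refine mul_le_mul (abs_cot_half_le (ht.trans hθ.1) hθ.2) ?_ (abs_nonneg _)
                  (mul_nonneg zero_le_two (inv_nonneg.2 (ht.trans hθ.1).le))
                rw [sub_sub_sub_comm]
                linarith [hfg (ξ - θ), hfg (ξ + θ)]
            _ = _ := by ring
      _ = _ := by rw [intervalIntegral.integral_const_mul, integral_inv h0]

/-- Two-function form of the first estimate of the paper's Lemma 6.2: for `2π`-periodic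
functions `f`, `g` that are `α`-Hölder with constant `K` and satisfy
`sup |f - g| ≤ K·t^α` with `t ∈ (0, 1/2]`, the Hilbert transforms are defined pointwise
and `|Hf(ξ) - Hg(ξ)| ≤ C·K·t^α·(1 + log(1/t))` with `C` depending only on `α`. -/
theorem stmt_10 (α : ℝ) (hα : α ∈ Set.Ioo (0:ℝ) 1) :
    ∃ C : ℝ, 0 < C ∧
      ∀ K t : ℝ, 0 < K → t ∈ Set.Ioc (0:ℝ) (1/2) →
      ∀ f g : ℝ → ℝ,
        Function.Periodic f (2*Real.pi) → Function.Periodic g (2*Real.pi) →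
        (∀ s u : ℝ, |f s - f u| ≤ K * |s - u| ^ α) →
        (∀ s u : ℝ, |g s - g u| ≤ K * |s - u| ^ α) →
        (∀ ξ : ℝ, |f ξ - g ξ| ≤ K * t ^ α) →
        ∀ ξ : ℝ, ∃ Lf Lg : ℝ,
          IsHilbertTransformAt f ξ Lf ∧ IsHilbertTransformAt g ξ Lg ∧
          |Lf - Lg| ≤ C * K * t ^ α * (1 + Real.log (1/t)) := by
  have hα0 : 0 < α := hα.1
  refine ⟨8 / α + 16, by positivity, fun K t hK ht f g _ _ hf hg hfg ξ => ⟨_, _,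
    isHilbertTransformAt_of_holder hα hK.le hf ξ, isHilbertTransformAt_of_holder hα hK.le hg ξ, ?_⟩⟩
  have ht0 : 0 < t := ht.1
  have hπ := Real.pi_gt_three
  have hlog : 0 ≤ Real.log (1 / t) :=
    Real.log_nonneg ((one_le_div ht0).2 (by linarith [ht.2]))
  have hlogπ : Real.log Real.pi ≤ 4 :=
    (Real.log_le_self Real.pi_pos.le).trans Real.pi_le_four
  have hsplit : Real.log (Real.pi / t) = Real.log Real.pi + Real.log (1 / t) := by
    rw [div_eq_mul_one_div, Real.log_mul Real.pi_ne_zero (by positivity)]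
  have hmain := abs_integral_foldedHilbertIntegrand_sub_le hα hK.le ht0
    (by linarith [ht.2]) hf hg hfg ξ
  rw [← mul_sub, abs_mul, abs_of_pos (by positivity)]
  have hinv : 1 / Real.pi ≤ 1 := (div_le_one Real.pi_pos).2 (by linarith)
  refine (mul_le_of_le_one_left (abs_nonneg _) hinv).trans (hmain.trans ?_)
  have hA : 0 ≤ K * t ^ α := by positivity
  rw [hsplit]
  calc _ = K * t ^ α * (8 / α + 4 * (Real.log Real.pi + Real.log (1 / t))) := by ring
    _ ≤ K * t ^ α * ((8 / α + 16) * (1 + Real.log (1 / t))) := by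
        gcongr
        have : 0 ≤ 8 / α * Real.log (1 / t) := by positivity
        linarith
    _ = _ := by ring
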